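/- For every natural number n, T_n(6/7) ≥ 1 − (16/17)^n. -/

import Mathlib

open Set Filter Topology

noncomputable section

/-- The dyadic tile `[a/2^i, (a+1)/2^i] × [b/2^j, (b+1)/2^j]` as a subset of `ℝ × ℝ`. -/
def dyadicTile (i j a b : ℕ) : Set (ℝ × ℝ) :=
  Set.Icc ((a : ℝ) / 2 ^ i) (((a : ℝ) + 1) / 2 ^ i) ×ˢ
    Set.Icc ((b : ℝ) / 2 ^ j) (((b : ℝ) + 1) / 2 ^ j)

/-- `t` is a dyadic tile of order `n` contained in the unit square. -/
def IsDyadicTile (n : ℕ) (t : Set (ℝ × ℝ)) : Prop :=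
  ∃ i j a b : ℕ, i + j = n ∧ a < 2 ^ i ∧ b < 2 ^ j ∧ t = dyadicTile i j a b

/-- `F` is a tiling of the region `R` by dyadic tiles of order `n`:
a set of order-`n` tiles whose union is `R` and whose interiors are pairwise disjoint. -/
def IsTiling (n : ℕ) (F : Set (Set (ℝ × ℝ))) (R : Set (ℝ × ℝ)) : Prop :=
  (∀ t ∈ F, IsDyadicTile n t) ∧ ⋃₀ F = R ∧
    F.Pairwise fun s t => interior s ∩ interior t = ∅

def unitSquare : Set (ℝ × ℝ) := Set.Icc (0 : ℝ) 1 ×ˢ Set.Icc (0 : ℝ) 1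

/-- Index type for the dyadic tiles of order `n`: a shape `i` (width `2^{-i}`, height
`2^{-(n-i)}`) together with the horizontal and vertical positions. -/
abbrev TileIndex (n : ℕ) : Type :=
  Σ i : Fin (n + 1), Fin (2 ^ (i : ℕ)) × Fin (2 ^ (n - (i : ℕ)))

/-- The order-`n` tile corresponding to an index. -/
def tileOf (n : ℕ) (x : TileIndex n) : Set (ℝ × ℝ) :=
  dyadicTile (x.1 : ℕ) (n - (x.1 : ℕ)) (x.2.1 : ℕ) (x.2.2 : ℕ)

/-- The set `S` of available order-`n` tiles admits a tiling of the unit square. -/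
def TileableSquare (n : ℕ) (S : Finset (TileIndex n)) : Prop :=
  ∃ F : Set (Set (ℝ × ℝ)), (∀ t ∈ F, ∃ x ∈ S, t = tileOf n x) ∧ IsTiling n F unitSquare

open Classical in
/-- Probability of the event `E` when each of the `(n+1)·2^n` order-`n` dyadic tiles is
available independently with probability `p`. -/
def Pr (n : ℕ) (p : ℝ) (E : Finset (TileIndex n) → Prop) : ℝ :=
  ∑ S : Finset (TileIndex n),
    if E S then p ^ S.card * (1 - p) ^ ((n + 1) * 2 ^ n - S.card) else 0

/-- `T n p`: the probability that some set of available order-`n` tiles tiles `[0,1]²`. -/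
def T (n : ℕ) (p : ℝ) : ℝ := Pr n p (TileableSquare n)

/-- The critical probability `p_c`. -/
def pc : ℝ :=
  sInf {p : ℝ | p ∈ Set.Icc (0 : ℝ) 1 ∧ Tendsto (fun n => T n p) atTop (𝓝 1)}

/-! ### Tiles addressed by binary words -/

/-- A dyadic tile addressed by the binary words of its horizontal and vertical positions, the most
recent bisection first. -/
abbrev WordTile : Type := List Bool × List Bool

/-- The position encoded by a binary word, least significant bit first. -/
def wordVal : List Bool → ℕ
  | [] => 0
  | c :: u => 2 * wordVal u + c.toNat

lemma wordVal_lt (u : List Bool) : wordVal u < 2 ^ u.length := by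
  induction u with
  | nil => simp [wordVal]
  | cons c u ih => cases c <;> simp [wordVal, pow_succ] <;> omega

lemma wordVal_inj {u v : List Bool} (hl : u.length = v.length) (h : wordVal u = wordVal v) :
    u = v := by
  induction u generalizing v with
  | nil => cases v <;> simp_all
  | cons c u ih =>
    cases v with
    | nil => simp at hl
    | cons d v =>
      simp only [List.length_cons, Nat.add_right_cancel_iff] at hl
      simp only [wordVal] at h
      cases c <;> cases d <;> simp at h ⊢ <;> first | exact ih hl (by omega) | omega

/-- `Blocked bad r t`: after `r` further bisections, `t` cannot be cut recursively into tiles none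
of which is `bad`. -/
def Blocked (bad : WordTile → Prop) : ℕ → WordTile → Prop
  | 0, t => bad t
  | r + 1, t => (∃ c, Blocked bad r (c :: t.1, t.2)) ∧ ∃ d, Blocked bad r (t.1, d :: t.2)

/-- The first `l` bits of `X`, most recent first. -/
def headBits (X : ℕ → Bool) : ℕ → List Bool
  | 0 => []
  | l + 1 => X l :: headBits X l

lemma headBits_congr {X X' : ℕ → Bool} {l : ℕ} (h : ∀ m < l, X m = X' m) :
    headBits X l = headBits X' l := by
  induction l with
  | zero => rfl
  | succ l ih =>
    simp only [headBits]
    rw [h l (by omega), ih fun m hm => h m (by omega)]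

lemma exists_headBits (w : List Bool) : ∃ X, headBits X w.length = w := by
  induction w with
  | nil => exact ⟨fun _ => false, rfl⟩
  | cons c u ih =>
    obtain ⟨X, hX⟩ := ih
    refine ⟨fun m => if m = u.length then c else X m, ?_⟩
    have h : headBits (fun m => if m = u.length then c else X m) u.length =
        headBits X u.length := headBits_congr fun m hm => if_neg hm.ne
    simp only [List.length_cons, headBits, if_true, h, hX]

/-- The tile of order `k` with `l` horizontal bisections containing the point `(X, Y)`. -/
def rayTile (X Y : ℕ → Bool) (k l : ℕ) : WordTile := (headBits X l, headBits Y (k - l))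

/-- Along the tiles of order `k` containing a given point, `A` is an interval in every run of
blocked tiles. -/
def RayConvex (bad : WordTile → Prop) (k r : ℕ) (A : Finset WordTile) : Prop :=
  ∀ X Y i l j, i ≤ l → l ≤ j → j ≤ k → rayTile X Y k i ∈ A → rayTile X Y k j ∈ A →
    (∀ m, i ≤ m → m ≤ j → Blocked bad r (rayTile X Y k m)) → rayTile X Y k l ∈ A

/-- No two halves of a tile, cut in the same direction, both belong to `A`. -/
def SiblingFree (A : Finset WordTile) : Prop :=
  (∀ u v c e, (c :: u, v) ∈ A → (e :: u, v) ∈ A → c = e) ∧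
    ∀ u v d e, (u, d :: v) ∈ A → (u, e :: v) ∈ A → d = e

/-- The tiles having both a horizontal and a vertical half in `A`. -/
def corners (A : Finset WordTile) : Finset WordTile :=
  (A.image fun t => (t.1, t.2.tail)).filter fun p =>
    (∃ c, (c :: p.1, p.2) ∈ A) ∧ ∃ d, (p.1, d :: p.2) ∈ A

lemma mem_corners {A : Finset WordTile} {p : WordTile} :
    p ∈ corners A ↔ (∃ c, (c :: p.1, p.2) ∈ A) ∧ ∃ d, (p.1, d :: p.2) ∈ A := by
  refine ⟨fun h => (Finset.mem_filter.1 h).2, fun h => Finset.mem_filter.2 ⟨?_, h⟩⟩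
  obtain ⟨-, d, hd⟩ := h
  exact Finset.mem_image.2 ⟨_, hd, rfl⟩

/-- Halve every tile of `A` in both directions, keeping the halves selected by `f` and `g`. -/
def children (A : Finset WordTile) (f g : WordTile → Bool) : Finset WordTile :=
  (A.image fun t => (f t :: t.1, t.2)) ∪ A.image fun t => (t.1, g t :: t.2)

lemma mem_children {A : Finset WordTile} {f g : WordTile → Bool} {s : WordTile} :
    s ∈ children A f g ↔
      (∃ t ∈ A, (f t :: t.1, t.2) = s) ∨ ∃ t ∈ A, (t.1, g t :: t.2) = s := by
  simp only [children, Finset.mem_union, Finset.mem_image]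

/-- At a corner of `A` the selections `f` and `g` both point to the common quarter if the corner
belongs to `K`, and both point away from it otherwise. -/
def Follows (A K : Finset WordTile) (f g : WordTile → Bool) : Prop :=
  ∀ u v c d, (c :: u, v) ∈ A → (u, d :: v) ∈ A →
    (f (u, d :: v) = if (u, v) ∈ K then c else !c) ∧
      g (c :: u, v) = if (u, v) ∈ K then d else !d

lemma SiblingFree.children {A K : Finset WordTile} {f g : WordTile → Bool} (hA : SiblingFree A)
    (hF : Follows A K f g) : SiblingFree (children A f g) := by
  have key : ∀ u w c c', (∃ t ∈ A, (f t :: t.1, t.2) = (c :: u, w)) →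
      (∃ t ∈ A, (t.1, g t :: t.2) = (c' :: u, w)) → c = c' := by
    rintro u w c c' ⟨⟨u₁, w₁⟩, h₁, e₁⟩ ⟨⟨u₂, w₂⟩, h₂, e₂⟩
    simp only [Prod.mk.injEq, List.cons.injEq] at e₁ e₂
    obtain ⟨⟨e, rfl⟩, rfl⟩ := e₁
    obtain ⟨rfl, rfl⟩ := e₂
    have := hF _ _ _ _ h₂ h₁
    revert this
    split_ifs <;> grind
  have key' : ∀ u w d d', (∃ t ∈ A, (f t :: t.1, t.2) = (u, d :: w)) →
      (∃ t ∈ A, (t.1, g t :: t.2) = (u, d' :: w)) → d = d' := by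
    rintro u w d d' ⟨⟨u₁, w₁⟩, h₁, e₁⟩ ⟨⟨u₂, w₂⟩, h₂, e₂⟩
    simp only [Prod.mk.injEq, List.cons.injEq] at e₁ e₂
    obtain ⟨rfl, rfl⟩ := e₁
    obtain ⟨rfl, e, rfl⟩ := e₂
    have := hF _ _ _ _ h₂ h₁
    revert this
    split_ifs <;> grind
  constructor
  · intro u v c c' h h'
    rw [mem_children] at h h'
    rcases h with h | h <;> rcases h' with h' | h'
    · grind
    · exact key _ _ _ _ h h'
    · exact (key _ _ _ _ h' h).symm
    · obtain ⟨⟨u₁, w₁⟩, h₁, e₁⟩ := h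
      obtain ⟨⟨u₂, w₂⟩, h₂, e₂⟩ := h'
      simp only [Prod.mk.injEq] at e₁ e₂
      obtain ⟨rfl, rfl⟩ := e₁
      obtain ⟨rfl, e⟩ := e₂
      simp only [List.cons.injEq] at e
      obtain ⟨-, rfl⟩ := e
      exact hA.1 _ _ _ _ h₁ h₂
  · intro u v d d' h h'
    rw [mem_children] at h h'
    rcases h with h | h <;> rcases h' with h' | h'
    · obtain ⟨⟨u₁, w₁⟩, h₁, e₁⟩ := h
      obtain ⟨⟨u₂, w₂⟩, h₂, e₂⟩ := h'
      simp only [Prod.mk.injEq] at e₁ e₂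
      obtain ⟨rfl, rfl⟩ := e₁
      obtain ⟨e, rfl⟩ := e₂
      simp only [List.cons.injEq] at e
      obtain ⟨-, rfl⟩ := e
      exact hA.2 _ _ _ _ h₁ h₂
    · exact key' _ _ _ _ h h'
    · exact (key' _ _ _ _ h' h).symm
    · grind

lemma two_mul_card_le_card_children {A K : Finset WordTile} {f g : WordTile → Bool}
    (hA : SiblingFree A) (hF : Follows A K f g) :
    2 * A.card ≤ (children A f g).card + K.card := by
  have hX : (A.image fun t => (f t :: t.1, t.2)).card = A.card :=
    Finset.card_image_of_injective _ fun s t h => by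
      simp only [Prod.mk.injEq, List.cons.injEq] at h
      exact Prod.ext h.1.2 h.2
  have hY : (A.image fun t => (t.1, g t :: t.2)).card = A.card :=
    Finset.card_image_of_injective _ fun s t h => by
      simp only [Prod.mk.injEq, List.cons.injEq] at h
      exact Prod.ext h.1 h.2.2
  have hmem : ∀ s, s ∈ (A.image fun t => (f t :: t.1, t.2)) ∩ (A.image fun t => (t.1, g t :: t.2)) →
      ∃ u v c d, s = (c :: u, d :: v) ∧ (c :: u, v) ∈ A ∧ (u, d :: v) ∈ A ∧ (u, v) ∈ K := by
    intro s hs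
    simp only [Finset.mem_inter, Finset.mem_image] at hs
    obtain ⟨⟨⟨u₁, w₁⟩, h₁, rfl⟩, ⟨u₂, w₂⟩, h₂, e₂⟩ := hs
    generalize hf : f (u₁, w₁) = a at *
    simp only [Prod.mk.injEq] at e₂
    obtain ⟨rfl, rfl⟩ := e₂
    refine ⟨_, _, _, _, rfl, h₂, h₁, ?_⟩
    have := (hF _ _ _ _ h₂ h₁).1
    by_contra hK
    simp [hK, hf] at this
  have hK : ((A.image fun t => (f t :: t.1, t.2)) ∩
      (A.image fun t => (t.1, g t :: t.2))).card ≤ K.card := by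
    refine Finset.card_le_card_of_injOn (fun s => (s.1.tail, s.2.tail)) ?_ ?_
    · intro s hs
      obtain ⟨u, v, c, d, rfl, -, -, h⟩ := hmem s hs
      exact h
    · intro s hs s' hs' e
      obtain ⟨u, v, c, d, rfl, h₁, h₂, -⟩ := hmem s hs
      obtain ⟨u', v', c', d', rfl, h₁', h₂', -⟩ := hmem s' hs'
      simp only [List.tail_cons, Prod.mk.injEq] at e
      obtain ⟨rfl, rfl⟩ := e
      rw [hA.1 _ _ _ _ h₁ h₁', hA.2 _ _ _ _ h₂ h₂']
  have := Finset.card_union_add_card_inter (A.image fun t => (f t :: t.1, t.2))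
    (A.image fun t => (t.1, g t :: t.2))
  rw [hX, hY] at this
  rw [children]
  omega

lemma rayTile_mem_children {A : Finset WordTile} {f g : WordTile → Bool} {X Y : ℕ → Bool}
    {k i : ℕ} (hi : i ≤ k + 1) (h : rayTile X Y (k + 1) i ∈ children A f g) :
    ∃ m ≤ k, m ≤ i ∧ i ≤ m + 1 ∧ rayTile X Y k m ∈ A := by
  rw [mem_children] at h
  rcases h with ⟨⟨u, w⟩, ht, e⟩ | ⟨⟨u, w⟩, ht, e⟩
  · cases i with
    | zero => simp [rayTile, headBits] at e
    | succ i =>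
      refine ⟨i, by omega, by omega, le_rfl, ?_⟩
      simp only [rayTile, headBits, Prod.mk.injEq, List.cons.injEq, Nat.add_sub_add_right] at e
      rwa [rayTile, ← e.1.2, ← e.2]
  · rcases Nat.lt_or_ge k i with hk | hk
    · obtain rfl : i = k + 1 := by omega
      simp [rayTile, headBits] at e
    · refine ⟨i, hk, le_rfl, by omega, ?_⟩
      rw [rayTile, Nat.sub_add_comm hk] at e
      simp only [headBits, Prod.mk.injEq, List.cons.injEq] at e
      rwa [rayTile, ← e.1, ← e.2.2]

lemma blocked_rayTile {bad : WordTile → Prop} {r k m : ℕ} {X Y : ℕ → Bool} (hm : m ≤ k)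
    (h₁ : Blocked bad r (rayTile X Y (k + 1) m))
    (h₂ : Blocked bad r (rayTile X Y (k + 1) (m + 1))) :
    Blocked bad (r + 1) (rayTile X Y k m) := by
  rw [rayTile, Nat.sub_add_comm hm] at h₁
  rw [rayTile, Nat.add_sub_add_right] at h₂
  exact ⟨⟨_, h₂⟩, ⟨_, h₁⟩⟩

lemma RayConvex.children {bad : WordTile → Prop} {k r : ℕ} {A K : Finset WordTile}
    {f g : WordTile → Bool} (hR : RayConvex bad k (r + 1) A)
    (hA : ∀ t ∈ A, Blocked bad (r + 1) t) (hF : Follows A K f g)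
    (hK : ∀ u v c d, (c :: u, v) ∈ A → (u, d :: v) ∈ A → Blocked bad r (c :: u, d :: v) →
      (u, v) ∈ K) :
    RayConvex bad (k + 1) r (children A f g) := by
  intro X Y i l j hil hlj hj hi' hj' hb
  rcases hil.eq_or_lt with rfl | hil
  · exact hi'
  rcases hlj.eq_or_lt with rfl | hlj
  · exact hj'
  obtain ⟨i₀, -, hi₁, hi₂, hi₀⟩ := rayTile_mem_children (by omega) hi'
  obtain ⟨j₀, hjk, hj₁, hj₂, hj₀⟩ := rayTile_mem_children hj hj'
  have hb' : ∀ m, i₀ ≤ m → m ≤ j₀ → Blocked bad (r + 1) (rayTile X Y k m) := by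
    intro m hm hm'
    rcases hm.eq_or_lt with rfl | hm
    · exact hA _ hi₀
    rcases hm'.eq_or_lt with rfl | hm'
    · exact hA _ hj₀
    exact blocked_rayTile (by omega) (hb _ (by omega) (by omega)) (hb _ (by omega) (by omega))
  obtain ⟨l, rfl⟩ : ∃ l', l = l' + 1 := ⟨l - 1, by omega⟩
  have h₁ := hR X Y i₀ l j₀ (by omega) (by omega) hjk hi₀ hj₀ hb'
  have h₂ := hR X Y i₀ (l + 1) j₀ (by omega) (by omega) hjk hi₀ hj₀ hb'
  have h₃ := hb (l + 1) (by omega) (by omega)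
  obtain ⟨e, he⟩ : ∃ e, k - l = e + 1 := ⟨k - l - 1, by omega⟩
  have he' : k - (l + 1) = e := by omega
  simp only [rayTile, he, he', Nat.add_sub_add_right, headBits] at h₁ h₂ h₃ ⊢
  refine mem_children.2 (Or.inl ⟨_, h₁, ?_⟩)
  rw [(hF _ _ _ _ h₂ h₁).1, if_pos (hK _ _ _ _ h₂ h₁ h₃)]

lemma corners_children_subset {bad : WordTile → Prop} {k r : ℕ} {A : Finset WordTile}
    {f g : WordTile → Bool} (hk : ∀ t ∈ A, t.1.length + t.2.length = k)
    (hR : RayConvex bad k (r + 1) A) (hA : ∀ t ∈ A, Blocked bad (r + 1) t)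
    (hC : ∀ t ∈ children A f g, Blocked bad r t) : corners (children A f g) ⊆ A := by
  rintro ⟨u, v⟩ hp
  obtain ⟨⟨c, hc⟩, d, hd⟩ := mem_corners.1 hp
  have hb : Blocked bad (r + 1) (u, v) := ⟨⟨c, hC _ hc⟩, ⟨d, hC _ hd⟩⟩
  rcases mem_children.1 hc with ⟨⟨u₁, w₁⟩, h₁, e₁⟩ | ⟨⟨u₁, w₁⟩, h₁, e₁⟩
  · simp only [Prod.mk.injEq, List.cons.injEq] at e₁
    rwa [← e₁.1.2, ← e₁.2]
  rcases mem_children.1 hd with ⟨⟨u₂, w₂⟩, h₂, e₂⟩ | ⟨⟨u₂, w₂⟩, h₂, e₂⟩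
  swap
  · simp only [Prod.mk.injEq, List.cons.injEq] at e₂
    rwa [← e₂.1, ← e₂.2.2]
  generalize g (u₁, w₁) = b at e₁
  generalize f (u₂, w₂) = a at e₂
  simp only [Prod.mk.injEq] at e₁ e₂
  obtain ⟨rfl, rfl⟩ := e₁
  obtain ⟨rfl, rfl⟩ := e₂
  obtain ⟨X, hX⟩ := exists_headBits (c :: a :: u₂)
  obtain ⟨Y, hY⟩ := exists_headBits (d :: b :: w₁)
  have hlen := hk _ h₁
  simp only [List.length_cons, headBits, List.cons.injEq] at hX hY hlen
  have hi : rayTile X Y k u₂.length = (u₂, d :: b :: w₁) := by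
    rw [rayTile, show k - u₂.length = w₁.length + 1 + 1 by omega]
    simp [headBits, hX, hY]
  have hl : rayTile X Y k (u₂.length + 1) = (a :: u₂, b :: w₁) := by
    rw [rayTile, show k - (u₂.length + 1) = w₁.length + 1 by omega]
    simp [headBits, hX, hY]
  have hj : rayTile X Y k (u₂.length + 2) = (c :: a :: u₂, w₁) := by
    rw [rayTile, show k - (u₂.length + 2) = w₁.length by omega]
    simp [headBits, hX, hY]
  rw [← hl]
  refine hR X Y u₂.length _ (u₂.length + 2) (by omega) (by omega) (by omega) (hi ▸ h₂) (hj ▸ h₁)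
    fun m hm hm' => ?_
  obtain rfl | rfl | rfl : m = u₂.length ∨ m = u₂.length + 1 ∨ m = u₂.length + 2 := by omega
  · rw [hi]; exact hA _ h₂
  · rw [hl]; exact hb
  · rw [hj]; exact hA _ h₁

/-! ### Selections of halves -/

/-- Which horizontal half of `p` belongs to `A`. -/
def bitX (A : Finset WordTile) (p : WordTile) : Bool := decide ((true :: p.1, p.2) ∈ A)

/-- Which vertical half of `p` belongs to `A`. -/
def bitY (A : Finset WordTile) (p : WordTile) : Bool := decide ((p.1, true :: p.2) ∈ A)

lemma SiblingFree.bitX_eq {A : Finset WordTile} (hA : SiblingFree A) {u v : List Bool} {c : Bool}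
    (h : (c :: u, v) ∈ A) : bitX A (u, v) = c := by
  cases c with
  | true => simpa [bitX] using h
  | false =>
    simp only [bitX, decide_eq_false_iff_not]
    exact fun ht => by simpa using hA.1 _ _ _ _ h ht

lemma SiblingFree.bitY_eq {A : Finset WordTile} (hA : SiblingFree A) {u v : List Bool} {d : Bool}
    (h : (u, d :: v) ∈ A) : bitY A (u, v) = d := by
  cases d with
  | true => simpa [bitY] using h
  | false =>
    simp only [bitY, decide_eq_false_iff_not]
    exact fun ht => by simpa using hA.2 _ _ _ _ h ht

/-- The vertical halves in `A` of the corners of `A`. -/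
def pairedX (A : Finset WordTile) : Finset WordTile :=
  (corners A).image fun p => (p.1, bitY A p :: p.2)

/-- The horizontal halves in `A` of the corners of `A`. -/
def pairedY (A : Finset WordTile) : Finset WordTile :=
  (corners A).image fun p => (bitX A p :: p.1, p.2)

lemma SiblingFree.card_sdiff_pairedX {A : Finset WordTile} (hA : SiblingFree A) :
    (A \ pairedX A).card + (corners A).card = A.card := by
  have hsub : pairedX A ⊆ A := by
    intro t ht
    obtain ⟨⟨u, v⟩, hp, rfl⟩ := Finset.mem_image.1 ht
    obtain ⟨-, d, hd⟩ := mem_corners.1 hp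
    simpa only [hA.bitY_eq hd] using hd
  have hcard : (pairedX A).card = (corners A).card :=
    Finset.card_image_of_injective _ fun s t h => by
      simp only [Prod.mk.injEq, List.cons.injEq] at h
      exact Prod.ext h.1 h.2.2
  rw [← hcard, Finset.card_sdiff_add_card_eq_card hsub]

lemma SiblingFree.card_sdiff_pairedY {A : Finset WordTile} (hA : SiblingFree A) :
    (A \ pairedY A).card + (corners A).card = A.card := by
  have hsub : pairedY A ⊆ A := by
    intro t ht
    obtain ⟨⟨u, v⟩, hp, rfl⟩ := Finset.mem_image.1 ht
    obtain ⟨⟨c, hc⟩, -⟩ := mem_corners.1 hp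
    simpa only [hA.bitX_eq hc] using hc
  have hcard : (pairedY A).card = (corners A).card :=
    Finset.card_image_of_injective _ fun s t h => by
      simp only [Prod.mk.injEq, List.cons.injEq] at h
      exact Prod.ext h.1.2 h.2
  rw [← hcard, Finset.card_sdiff_add_card_eq_card hsub]

/-- The horizontal selection determined by the kept corners `K` and a free choice `U` on the tiles
outside `pairedX A`. -/
def selectX (A K U : Finset WordTile) (t : WordTile) : Bool :=
  if t ∈ pairedX A then
    if (t.1, t.2.tail) ∈ K then bitX A (t.1, t.2.tail) else !bitX A (t.1, t.2.tail)
  else decide (t ∈ U)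

/-- The vertical selection determined by the kept corners `K` and a free choice `U` on the tiles
outside `pairedY A`. -/
def selectY (A K U : Finset WordTile) (t : WordTile) : Bool :=
  if t ∈ pairedY A then
    if (t.1.tail, t.2) ∈ K then bitY A (t.1.tail, t.2) else !bitY A (t.1.tail, t.2)
  else decide (t ∈ U)

lemma SiblingFree.follows_select {A : Finset WordTile} (hA : SiblingFree A)
    (K U V : Finset WordTile) : Follows A K (selectX A K U) (selectY A K V) := by
  intro u v c d hc hd
  have hp : (u, v) ∈ corners A := mem_corners.2 ⟨⟨c, hc⟩, ⟨d, hd⟩⟩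
  have hX : (u, d :: v) ∈ pairedX A := Finset.mem_image.2 ⟨_, hp, by simp [hA.bitY_eq hd]⟩
  have hY : (c :: u, v) ∈ pairedY A := Finset.mem_image.2 ⟨_, hp, by simp [hA.bitX_eq hc]⟩
  simp [selectX, selectY, hX, hY, hA.bitX_eq hc, hA.bitY_eq hd]

lemma exists_select {bad : WordTile → Prop} {r : ℕ} {A : Finset WordTile} (hA : SiblingFree A)
    (hb : ∀ t ∈ A, Blocked bad (r + 1) t) :
    ∃ K ⊆ corners A, ∃ U ⊆ A \ pairedX A, ∃ V ⊆ A \ pairedY A,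
      (∀ t ∈ children A (selectX A K U) (selectY A K V), Blocked bad r t) ∧
      ∀ u v c d, (c :: u, v) ∈ A → (u, d :: v) ∈ A → Blocked bad r (c :: u, d :: v) →
        (u, v) ∈ K := by
  classical
  let K := (corners A).filter fun p => Blocked bad r (bitX A p :: p.1, bitY A p :: p.2)
  let U := (A \ pairedX A).filter fun t => Blocked bad r (true :: t.1, t.2)
  let V := (A \ pairedY A).filter fun t => Blocked bad r (t.1, true :: t.2)
  have hK : ∀ u v c d, (c :: u, v) ∈ A → (u, d :: v) ∈ A →
      ((u, v) ∈ K ↔ Blocked bad r (c :: u, d :: v)) := by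
    intro u v c d hc hd
    have hp : (u, v) ∈ corners A := mem_corners.2 ⟨⟨c, hc⟩, ⟨d, hd⟩⟩
    simp [K, hp, hA.bitX_eq hc, hA.bitY_eq hd]
  refine ⟨K, Finset.filter_subset _ _, U, Finset.filter_subset _ _, V, Finset.filter_subset _ _,
    ?_, fun u v c d hc hd h => (hK u v c d hc hd).2 h⟩
  have hF := hA.follows_select K U V
  intro s hs
  rcases mem_children.1 hs with ⟨t, ht, rfl⟩ | ⟨t, ht, rfl⟩
  · obtain ⟨c', hc'⟩ := (hb t ht).1
    by_cases hX : t ∈ pairedX A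
    · obtain ⟨⟨u, v⟩, hp, rfl⟩ := Finset.mem_image.1 hX
      obtain ⟨⟨c, hc⟩, -⟩ := mem_corners.1 hp
      generalize bitY A (u, v) = d at *
      simp only at ht hc hc' ⊢
      rw [(hF u v c d hc ht).1]
      by_cases hB : Blocked bad r (c :: u, d :: v)
      · rwa [if_pos ((hK u v c d hc ht).2 hB)]
      · rw [if_neg (mt (hK u v c d hc ht).1 hB)]
        cases c <;> cases c' <;> first | exact hc' | exact absurd hc' hB
    · by_cases hB : Blocked bad r (true :: t.1, t.2)
      · have : t ∈ U := Finset.mem_filter.2 ⟨Finset.mem_sdiff.2 ⟨ht, hX⟩, hB⟩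
        simpa [selectX, hX, this] using hB
      · have : t ∉ U := fun h => hB (Finset.mem_filter.1 h).2
        cases c' with
        | true => exact absurd hc' hB
        | false => simpa [selectX, hX, this] using hc'
  · obtain ⟨d', hd'⟩ := (hb t ht).2
    by_cases hY : t ∈ pairedY A
    · obtain ⟨⟨u, v⟩, hp, rfl⟩ := Finset.mem_image.1 hY
      obtain ⟨-, d, hd⟩ := mem_corners.1 hp
      generalize bitX A (u, v) = c at *
      simp only at ht hd hd' ⊢
      rw [(hF u v c d ht hd).2]
      by_cases hB : Blocked bad r (c :: u, d :: v)
      · rwa [if_pos ((hK u v c d ht hd).2 hB)]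
      · rw [if_neg (mt (hK u v c d ht hd).1 hB)]
        cases d <;> cases d' <;> first | exact hd' | exact absurd hd' hB
    · by_cases hB : Blocked bad r (t.1, true :: t.2)
      · have : t ∈ V := Finset.mem_filter.2 ⟨Finset.mem_sdiff.2 ⟨ht, hY⟩, hB⟩
        simpa [selectY, hY, this] using hB
      · have : t ∉ V := fun h => hB (Finset.mem_filter.1 h).2
        cases d' with
        | true => exact absurd hd' hB
        | false => simpa [selectY, hY, this] using hd'

/-! ### The recursion for the weights -/

/-- The weights `(β, x)` bounding the probability that a set of tiles with `r` bisections left is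
blocked: each corner contributes a factor `β`, each connected chain of tiles a factor `x`. -/
def chainWeight : ℕ → ℝ × ℝ
  | 0 => (1 / 7, 1 / 7)
  | r + 1 => ((chainWeight r).1 * (1 + (chainWeight r).2),
      4 * (chainWeight r).1 * (chainWeight r).2)

lemma chainWeight_pos (r : ℕ) : 0 < (chainWeight r).1 ∧ 0 < (chainWeight r).2 := by
  induction r with
  | zero => norm_num [chainWeight]
  | succ r ih =>
    obtain ⟨h₁, h₂⟩ := ih
    constructor <;> simp only [chainWeight] <;> positivity

lemma chainWeight_succ_le {r : ℕ} {b x : ℝ} (hb : (chainWeight r).1 ≤ b)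
    (hx : (chainWeight r).2 ≤ x) (b' x' : ℝ) (hb' : b * (1 + x) ≤ b') (hx' : 4 * b * x ≤ x') :
    (chainWeight (r + 1)).1 ≤ b' ∧ (chainWeight (r + 1)).2 ≤ x' := by
  obtain ⟨h₁, h₂⟩ := chainWeight_pos r
  have := h₁.trans_le hb
  constructor
  · refine le_trans ?_ hb'
    simp only [chainWeight]
    gcongr
  · refine le_trans ?_ hx'
    simp only [chainWeight]
    gcongr

lemma chainWeight_sixteen_snd_le :
    (chainWeight 16).2 ≤ (4 / 17 - (chainWeight 16).1) / 4 := by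
  have h := chainWeight_succ_le (r := 0) le_rfl le_rfl (163266 / 1000000) (81633 / 1000000)
    (by norm_num [chainWeight]) (by norm_num [chainWeight])
  replace h := chainWeight_succ_le h.1 h.2 (176594 / 1000000) (53312 / 1000000)
    (by norm_num) (by norm_num)
  replace h := chainWeight_succ_le h.1 h.2 (186009 / 1000000) (37659 / 1000000)
    (by norm_num) (by norm_num)
  replace h := chainWeight_succ_le h.1 h.2 (193014 / 1000000) (28020 / 1000000)
    (by norm_num) (by norm_num)
  replace h := chainWeight_succ_le h.1 h.2 (198423 / 1000000) (21634 / 1000000)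
    (by norm_num) (by norm_num)
  replace h := chainWeight_succ_le h.1 h.2 (202716 / 1000000) (17171 / 1000000)
    (by norm_num) (by norm_num)
  replace h := chainWeight_succ_le h.1 h.2 (206197 / 1000000) (13924 / 1000000)
    (by norm_num) (by norm_num)
  replace h := chainWeight_succ_le h.1 h.2 (209069 / 1000000) (11485 / 1000000)
    (by norm_num) (by norm_num)
  replace h := chainWeight_succ_le h.1 h.2 (211471 / 1000000) (9605 / 1000000)
    (by norm_num) (by norm_num)
  replace h := chainWeight_succ_le h.1 h.2 (213503 / 1000000) (8125 / 1000000)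
    (by norm_num) (by norm_num)
  replace h := chainWeight_succ_le h.1 h.2 (215238 / 1000000) (6939 / 1000000)
    (by norm_num) (by norm_num)
  replace h := chainWeight_succ_le h.1 h.2 (216732 / 1000000) (5975 / 1000000)
    (by norm_num) (by norm_num)
  replace h := chainWeight_succ_le h.1 h.2 (218027 / 1000000) (5180 / 1000000)
    (by norm_num) (by norm_num)
  replace h := chainWeight_succ_le h.1 h.2 (219157 / 1000000) (4518 / 1000000)
    (by norm_num) (by norm_num)
  replace h := chainWeight_succ_le h.1 h.2 (220148 / 1000000) (3961 / 1000000)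
    (by norm_num) (by norm_num)
  replace h := chainWeight_succ_le h.1 h.2 (221021 / 1000000) (3489 / 1000000)
    (by norm_num) (by norm_num)
  obtain ⟨h₁, h₂⟩ := h
  norm_num at h₁ h₂
  linarith

lemma chainWeight_fst_le (r : ℕ) : (chainWeight r).1 ≤ 4 / 17 := by
  rcases Nat.lt_or_ge r 16 with h | h
  · exact (monotone_nat_of_le_succ (fun r => by
      obtain ⟨h₁, h₂⟩ := chainWeight_pos r
      simp only [chainWeight]
      nlinarith : ∀ r, (chainWeight r).1 ≤ (chainWeight (r + 1)).1) h.le).trans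
      (by linarith [chainWeight_sixteen_snd_le, chainWeight_pos 16])
  · obtain ⟨s, rfl⟩ := Nat.exists_eq_add_of_le h
    have key : (chainWeight (16 + s)).2 ≤ (4 / 17 - (chainWeight (16 + s)).1) / 4 := by
      clear h
      induction s with
      | zero => exact chainWeight_sixteen_snd_le
      | succ s ih =>
        obtain ⟨h₁, h₂⟩ := chainWeight_pos (16 + s)
        rw [← add_assoc]
        simp only [chainWeight]
        nlinarith [mul_pos h₁ h₂]
    linarith [(chainWeight_pos (16 + s)).2]

lemma chainWeight_snd_le (r : ℕ) : (chainWeight r).2 ≤ 1 / 7 * (16 / 17) ^ r := by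
  induction r with
  | zero => norm_num [chainWeight]
  | succ r ih =>
    have h₁ := chainWeight_fst_le r
    obtain ⟨h₂, h₃⟩ := chainWeight_pos r
    simp only [chainWeight, pow_succ]
    nlinarith

lemma chainWeight_snd_le_one_seventh (r : ℕ) : (chainWeight r).2 ≤ 1 / 7 :=
  (chainWeight_snd_le r).trans
    (mul_le_of_le_one_right (by norm_num) (pow_le_one₀ (by norm_num) (by norm_num)))

lemma chainWeight_snd_le_fst (r : ℕ) : (chainWeight r).2 ≤ (chainWeight r).1 := by
  cases r with
  | zero => simp [chainWeight]
  | succ r =>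
    have := chainWeight_snd_le_one_seventh r
    obtain ⟨h₁, h₂⟩ := chainWeight_pos r
    simp only [chainWeight]
    nlinarith

lemma pow_mul_pow_sub_le {b x : ℝ} (hx : 0 ≤ x) (hxb : x ≤ b) (hx1 : x ≤ 1) {p a p' a' k : ℕ}
    (hp : p' ≤ a) (hk : k ≤ p) (hpa : p ≤ a) (ha : 2 * a ≤ a' + k) :
    b ^ p' * x ^ (a' - p') ≤ b ^ a * x ^ (a - k) := by
  have hb : 0 ≤ b := hx.trans hxb
  calc b ^ p' * x ^ (a' - p') ≤ b ^ p' * x ^ ((a - p') + (a - k)) :=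
        mul_le_mul_of_nonneg_left (pow_le_pow_of_le_one hx hx1 (by omega)) (pow_nonneg hb _)
    _ = b ^ p' * x ^ (a - p') * x ^ (a - k) := by rw [pow_add]; ring
    _ ≤ b ^ p' * b ^ (a - p') * x ^ (a - k) := by gcongr
    _ = b ^ a * x ^ (a - k) := by rw [← pow_add, Nat.add_sub_cancel' hp]

lemma sum_select_weight {ι : Type*} (P U V : Finset ι) (b x : ℝ) {a : ℕ}
    (hU : U.card + P.card = a) (hV : V.card + P.card = a) :
    ∑ z ∈ P.powerset ×ˢ U.powerset ×ˢ V.powerset, b ^ a * x ^ (a - z.1.card) =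
      (b * (1 + x)) ^ P.card * (4 * b * x) ^ (a - P.card) := by
  obtain rfl : a = U.card + P.card := hU.symm
  have hUV : V.card = U.card := by omega
  have h1 : ∑ K ∈ P.powerset, x ^ (U.card + P.card - K.card) =
      x ^ U.card * (1 + x) ^ P.card := by
    rw [← Finset.sum_pow_mul_eq_add_pow, Finset.mul_sum]
    refine Finset.sum_congr rfl fun K hK => ?_
    have := Finset.card_le_card (Finset.mem_powerset.1 hK)
    rw [one_pow, one_mul, ← pow_add]
    congr 1
    omega
  rw [Finset.sum_product]
  simp only [Finset.sum_const, Finset.card_product, Finset.card_powerset, nsmul_eq_mul, hUV]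
  rw [← Finset.mul_sum, ← Finset.mul_sum, h1, Nat.add_sub_cancel]
  push_cast
  rw [show (4 : ℝ) = 2 * 2 by norm_num]
  simp only [mul_pow, pow_add]
  ring

/-! ### The union bound -/

open Classical in
lemma sum_blocked_le {Ω : Type*} [Fintype Ω] (w : Ω → ℝ) (hw : ∀ ω, 0 ≤ w ω)
    (bad : Ω → WordTile → Prop) (n : ℕ)
    (hbad : ∀ B : Finset WordTile, (∀ t ∈ B, t.1.length + t.2.length = n) →
      ∑ ω with ∀ t ∈ B, bad ω t, w ω ≤ (1 / 7) ^ B.card)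
    (r : ℕ) : ∀ (k : ℕ) (A : Finset WordTile), k + r = n →
      (∀ t ∈ A, t.1.length + t.2.length = k) → SiblingFree A →
      ∑ ω with (∀ t ∈ A, Blocked (bad ω) r t) ∧ RayConvex (bad ω) k r A, w ω ≤
        (chainWeight r).1 ^ (corners A).card *
          (chainWeight r).2 ^ (A.card - (corners A).card) := by
  induction r with
  | zero =>
    intro k A hk hA hS
    have hc := hS.card_sdiff_pairedX
    refine le_trans (Finset.sum_le_sum_of_subset_of_nonneg ?_ fun ω _ _ => hw ω)
      ((hbad A fun t ht => (hA t ht).trans (by omega)).trans_eq ?_)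
    · intro ω hω
      simp only [Finset.mem_filter, Finset.mem_univ, true_and] at hω ⊢
      exact hω.1
    · simp only [chainWeight]
      rw [← pow_add, Nat.add_sub_cancel' (by omega)]
  | succ r ih =>
    intro k A hk hA hS
    set b := (chainWeight r).1 with hb
    set x := (chainWeight r).2 with hx
    have hcX := hS.card_sdiff_pairedX
    have hcY := hS.card_sdiff_pairedY
    set Q : Finset Ω := Finset.univ.filter fun ω =>
      (∀ t ∈ A, Blocked (bad ω) (r + 1) t) ∧ RayConvex (bad ω) k (r + 1) A with hQ
    let next (z : Finset WordTile × Finset WordTile × Finset WordTile) : Finset WordTile :=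
      children A (selectX A z.1 z.2.1) (selectY A z.1 z.2.2)
    let R (z : Finset WordTile × Finset WordTile × Finset WordTile) : Finset Ω :=
      Q.filter fun ω => (∀ t ∈ next z, Blocked (bad ω) r t) ∧
        RayConvex (bad ω) (k + 1) r (next z)
    let I := (corners A).powerset ×ˢ (A \ pairedX A).powerset ×ˢ (A \ pairedY A).powerset
    have hcover : Q ⊆ I.biUnion R := by
      intro ω hω
      obtain ⟨hB, hR⟩ := (Finset.mem_filter.1 hω).2
      obtain ⟨K, hK, U, hU, V, hV, hC, hkeep⟩ := exists_select hS hB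
      refine Finset.mem_biUnion.2 ⟨(K, U, V), ?_, Finset.mem_filter.2 ⟨hω, hC, ?_⟩⟩
      · simp only [I, Finset.mem_product, Finset.mem_powerset]
        exact ⟨hK, hU, hV⟩
      · exact hR.children hB (hS.follows_select K U V) hkeep
    have hterm : ∀ z ∈ I, ∑ ω ∈ R z, w ω ≤ b ^ A.card * x ^ (A.card - z.1.card) := by
      rintro ⟨K, U, V⟩ hz
      simp only [I, Finset.mem_product, Finset.mem_powerset] at hz
      have hF := hS.follows_select K U V
      rcases (R (K, U, V)).eq_empty_or_nonempty with h0 | ⟨ω, hω⟩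
      · rw [h0, Finset.sum_empty]
        have := chainWeight_pos r
        exact mul_nonneg (pow_nonneg this.1.le _) (pow_nonneg this.2.le _)
      obtain ⟨hω, hC, -⟩ := Finset.mem_filter.1 hω
      obtain ⟨hB, hR⟩ := (Finset.mem_filter.1 hω).2
      have hsub := corners_children_subset hA hR hB hC
      refine le_trans (Finset.sum_le_sum_of_subset_of_nonneg ?_ fun ω _ _ => hw ω)
        ((ih (k + 1) (next (K, U, V)) (by omega) ?_ (hS.children hF)).trans
          (pow_mul_pow_sub_le (chainWeight_pos r).2.le (chainWeight_snd_le_fst r)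
            ((chainWeight_snd_le_one_seventh r).trans (by norm_num))
            (Finset.card_le_card hsub) (Finset.card_le_card hz.1) (by omega)
            (two_mul_card_le_card_children hS hF)))
      · intro ω hω
        exact Finset.mem_filter.2 ⟨Finset.mem_univ _, (Finset.mem_filter.1 hω).2⟩
      · intro s hs
        rcases mem_children.1 hs with ⟨t, ht, rfl⟩ | ⟨t, ht, rfl⟩
        · have := hA t ht
          simp only [List.length_cons]
          omega
        · have := hA t ht
          simp only [List.length_cons]
          omega
    calc ∑ ω ∈ Q, w ω ≤ ∑ ω ∈ I.biUnion R, w ω :=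
          Finset.sum_le_sum_of_subset_of_nonneg hcover fun ω _ _ => hw ω
      _ ≤ ∑ z ∈ I, ∑ ω ∈ R z, w ω := by
          have h : ∀ ω ∈ I.biUnion R, w ω ≤ ∑ z ∈ I, if ω ∈ R z then w ω else 0 := by
            intro ω hω
            obtain ⟨z, hz, hωz⟩ := Finset.mem_biUnion.1 hω
            refine (if_pos hωz).symm.trans_le
              (Finset.single_le_sum (f := fun z => if ω ∈ R z then w ω else 0) ?_ hz)
            intro y _
            split_ifs
            exacts [hw ω, le_rfl]
          refine (Finset.sum_le_sum h).trans_eq ?_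
          rw [Finset.sum_comm]
          refine Finset.sum_congr rfl fun z hz => ?_
          rw [← Finset.sum_filter, Finset.filter_mem_eq_inter,
            Finset.inter_eq_right.2 (Finset.subset_biUnion_of_mem R hz)]
      _ ≤ ∑ z ∈ I, b ^ A.card * x ^ (A.card - z.1.card) := Finset.sum_le_sum hterm
      _ = _ := sum_select_weight _ _ _ b x hcX hcY

/-! ### Geometry of tilings -/

lemma IsTiling.union {n : ℕ} {F G : Set (Set (ℝ × ℝ))} {R R' : Set (ℝ × ℝ)}
    (hF : IsTiling n F R) (hG : IsTiling n G R') (h : interior R ∩ interior R' = ∅) :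
    IsTiling n (F ∪ G) (R ∪ R') := by
  obtain ⟨hF₁, hF₂, hF₃⟩ := hF
  obtain ⟨hG₁, hG₂, hG₃⟩ := hG
  have key : ∀ s ∈ F, ∀ t ∈ G, interior s ∩ interior t = ∅ := by
    intro s hs t ht
    rw [← Set.subset_empty_iff, ← h, ← hF₂, ← hG₂]
    exact Set.inter_subset_inter (interior_mono (Set.subset_sUnion_of_mem hs))
      (interior_mono (Set.subset_sUnion_of_mem ht))
  refine ⟨?_, by rw [Set.sUnion_union, hF₂, hG₂], ?_⟩
  · rintro t (ht | ht)
    exacts [hF₁ t ht, hG₁ t ht]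
  · rintro s (hs | hs) t (ht | ht) hst
    · exact hF₃ hs ht hst
    · exact key s hs t ht
    · rw [Set.inter_comm]
      exact key t ht s hs
    · exact hG₃ hs ht hst

lemma Icc_dyadic_split (i a : ℕ) :
    Set.Icc (((2 * a + 0 : ℕ) : ℝ) / 2 ^ (i + 1)) ((((2 * a + 0 : ℕ) : ℝ) + 1) / 2 ^ (i + 1)) ∪
      Set.Icc (((2 * a + 1 : ℕ) : ℝ) / 2 ^ (i + 1)) ((((2 * a + 1 : ℕ) : ℝ) + 1) / 2 ^ (i + 1)) =
      Set.Icc ((a : ℝ) / 2 ^ i) (((a : ℝ) + 1) / 2 ^ i) := by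
  have h : (0 : ℝ) < 2 ^ i := by positivity
  have e₁ : ((2 * a + 0 : ℕ) : ℝ) / 2 ^ (i + 1) = (a : ℝ) / 2 ^ i := by
    push_cast; rw [pow_succ]; field_simp; ring
  have e₂ : (((2 * a + 1 : ℕ) : ℝ) + 1) / 2 ^ (i + 1) = ((a : ℝ) + 1) / 2 ^ i := by
    push_cast; rw [pow_succ]; field_simp; ring
  have e₃ : ((2 * a + 1 : ℕ) : ℝ) / 2 ^ (i + 1) = (((2 * a + 0 : ℕ) : ℝ) + 1) / 2 ^ (i + 1) := by
    push_cast; ring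
  rw [e₃, Set.Icc_union_Icc_eq_Icc, e₁, e₂]
  · gcongr; linarith
  · rw [← e₃]; gcongr; linarith

lemma Ioo_dyadic_inter (i a : ℕ) :
    Set.Ioo (((2 * a + 0 : ℕ) : ℝ) / 2 ^ (i + 1)) ((((2 * a + 0 : ℕ) : ℝ) + 1) / 2 ^ (i + 1)) ∩
      Set.Ioo (((2 * a + 1 : ℕ) : ℝ) / 2 ^ (i + 1))
        ((((2 * a + 1 : ℕ) : ℝ) + 1) / 2 ^ (i + 1)) = ∅ := by
  ext y
  simp only [Set.mem_inter_iff, Set.mem_Ioo, Set.mem_empty_iff_false, iff_false]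
  rintro ⟨⟨-, h₁⟩, h₂, -⟩
  refine absurd (h₂.trans h₁) (not_lt.2 ?_)
  push_cast
  gcongr
  linarith

lemma dyadicTile_split_left (i j a b : ℕ) :
    dyadicTile (i + 1) j (2 * a + 0) b ∪ dyadicTile (i + 1) j (2 * a + 1) b =
      dyadicTile i j a b := by
  rw [dyadicTile, dyadicTile, ← Set.union_prod, Icc_dyadic_split, dyadicTile]

lemma dyadicTile_split_right (i j a b : ℕ) :
    dyadicTile i (j + 1) a (2 * b + 0) ∪ dyadicTile i (j + 1) a (2 * b + 1) =
      dyadicTile i j a b := by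
  rw [dyadicTile, dyadicTile, ← Set.prod_union, Icc_dyadic_split, dyadicTile]

lemma interior_dyadicTile_inter_left (i j a b : ℕ) :
    interior (dyadicTile (i + 1) j (2 * a + 0) b) ∩
      interior (dyadicTile (i + 1) j (2 * a + 1) b) = ∅ := by
  rw [dyadicTile, dyadicTile, interior_prod_eq, interior_prod_eq, Set.prod_inter_prod,
    interior_Icc, interior_Icc, Ioo_dyadic_inter, Set.empty_prod]

lemma interior_dyadicTile_inter_right (i j a b : ℕ) :
    interior (dyadicTile i (j + 1) a (2 * b + 0)) ∩
      interior (dyadicTile i (j + 1) a (2 * b + 1)) = ∅ := by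
  rw [dyadicTile, dyadicTile, interior_prod_eq, interior_prod_eq, Set.prod_inter_prod,
    interior_Icc (a := _ / 2 ^ (j + 1)), interior_Icc (a := _ / 2 ^ (j + 1)), Ioo_dyadic_inter,
    Set.prod_empty]

/-- The order-`n` tile addressed by a pair of words of total length `n`. -/
def wordIndex {n : ℕ} (t : WordTile) (h : t.1.length + t.2.length = n) : TileIndex n :=
  ⟨⟨t.1.length, by omega⟩, ⟨wordVal t.1, wordVal_lt t.1⟩, ⟨wordVal t.2, by
    have h₂ : n - t.1.length = t.2.length := by omega
    simpa only [h₂] using wordVal_lt t.2⟩⟩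

lemma wordIndex_inj {n : ℕ} {s t : WordTile} (hs : s.1.length + s.2.length = n)
    (ht : t.1.length + t.2.length = n) (h : wordIndex s hs = wordIndex t ht) : s = t := by
  have h₁ : s.1.length = t.1.length :=
    congrArg (fun x : TileIndex n => (x.1 : ℕ)) h
  have h₂ : wordVal s.1 = wordVal t.1 :=
    congrArg (fun x : TileIndex n => (x.2.1 : ℕ)) h
  have h₃ : wordVal s.2 = wordVal t.2 :=
    congrArg (fun x : TileIndex n => (x.2.2 : ℕ)) h
  exact Prod.ext (wordVal_inj h₁ h₂) (wordVal_inj (by omega) h₃)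

/-- The tile addressed by a pair of words is not in `S`. -/
def Unavailable {n : ℕ} (S : Finset (TileIndex n)) (t : WordTile) : Prop :=
  ∀ h : t.1.length + t.2.length = n, wordIndex t h ∉ S

lemma exists_tiling_of_not_blocked {n : ℕ} (S : Finset (TileIndex n)) (r : ℕ) :
    ∀ u v : List Bool, u.length + v.length + r = n → ¬ Blocked (Unavailable S) r (u, v) →
      ∃ F : Set (Set (ℝ × ℝ)), (∀ t ∈ F, ∃ x ∈ S, t = tileOf n x) ∧
        IsTiling n F (dyadicTile u.length v.length (wordVal u) (wordVal v)) := by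
  induction r with
  | zero =>
    intro u v hn hB
    simp only [Blocked, Unavailable, not_forall, not_not] at hB
    obtain ⟨h, hS⟩ := hB
    have hv : n - u.length = v.length := by omega
    refine ⟨{dyadicTile u.length v.length (wordVal u) (wordVal v)}, ?_, ?_, by simp, by simp⟩
    · rintro t rfl
      exact ⟨_, hS, by simp [tileOf, wordIndex, hv]⟩
    · rintro t rfl
      exact ⟨u.length, v.length, _, _, hn, wordVal_lt u, wordVal_lt v, rfl⟩
  | succ r ih =>
    intro u v hn hB
    simp only [Blocked, not_and_or, not_exists] at hB
    rcases hB with hB | hB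
    · obtain ⟨F, hF, hF'⟩ := ih (false :: u) v (by simp only [List.length_cons]; omega) (hB false)
      obtain ⟨G, hG, hG'⟩ := ih (true :: u) v (by simp only [List.length_cons]; omega) (hB true)
      refine ⟨F ∪ G, fun t ht => ht.elim (hF t) (hG t), ?_⟩
      rw [← dyadicTile_split_left]
      exact hF'.union hG' (interior_dyadicTile_inter_left _ _ _ _)
    · obtain ⟨F, hF, hF'⟩ := ih u (false :: v) (by simp only [List.length_cons]; omega) (hB false)
      obtain ⟨G, hG, hG'⟩ := ih u (true :: v) (by simp only [List.length_cons]; omega) (hB true)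
      refine ⟨F ∪ G, fun t ht => ht.elim (hF t) (hG t), ?_⟩
      rw [← dyadicTile_split_right]
      exact hF'.union hG' (interior_dyadicTile_inter_right _ _ _ _)

lemma tileableSquare_of_not_blocked {n : ℕ} {S : Finset (TileIndex n)}
    (h : ¬ Blocked (Unavailable S) n ([], [])) : TileableSquare n S := by
  obtain ⟨F, hF, hF'⟩ := exists_tiling_of_not_blocked S n [] [] (by simp) h
  refine ⟨F, hF, ?_⟩
  simpa [dyadicTile, wordVal, unitSquare] using hF'

/-! ### Probabilities -/

lemma card_tileIndex (n : ℕ) : Fintype.card (TileIndex n) = (n + 1) * 2 ^ n := by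
  rw [Fintype.card_sigma]
  have : ∀ i : Fin (n + 1),
      Fintype.card (Fin (2 ^ (i : ℕ)) × Fin (2 ^ (n - (i : ℕ)))) = 2 ^ n := by
    intro i
    rw [Fintype.card_prod, Fintype.card_fin, Fintype.card_fin, ← pow_add,
      Nat.add_sub_cancel' (Nat.lt_succ_iff.1 i.2)]
  simp [this]

lemma sum_disjoint_weight {α : Type*} [Fintype α] [DecidableEq α] (p : ℝ) (B : Finset α) :
    ∑ S : Finset α with Disjoint S B, p ^ S.card * (1 - p) ^ (Fintype.card α - S.card) =
      (1 - p) ^ B.card := by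
  have hset : (Finset.univ.filter fun S : Finset α => Disjoint S B) = Bᶜ.powerset := by
    ext S
    simp [Finset.subset_compl_iff_disjoint_right]
  have hB : B.card ≤ Fintype.card α := Finset.card_le_univ B
  have hsum := Finset.sum_pow_mul_eq_add_pow p (1 - p) Bᶜ
  rw [add_sub_cancel, one_pow] at hsum
  have hmul : (1 - p) ^ B.card = (1 - p) ^ B.card *
      ∑ S ∈ Bᶜ.powerset, p ^ S.card * (1 - p) ^ (Bᶜ.card - S.card) := by rw [hsum, mul_one]
  rw [hset, hmul, Finset.mul_sum]
  refine Finset.sum_congr rfl fun S hS => ?_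
  have hS := Finset.card_le_card (Finset.mem_powerset.1 hS)
  rw [Finset.card_compl] at hS ⊢
  rw [mul_left_comm, ← pow_add]
  congr 2
  omega

open Classical in
lemma sum_unavailable_le (n : ℕ) (B : Finset WordTile)
    (hB : ∀ t ∈ B, t.1.length + t.2.length = n) :
    ∑ S : Finset (TileIndex n) with ∀ t ∈ B, Unavailable S t,
      (6 / 7 : ℝ) ^ S.card * (1 - 6 / 7) ^ ((n + 1) * 2 ^ n - S.card) ≤ (1 / 7) ^ B.card := by
  set C : Finset (TileIndex n) := B.attach.image fun t => wordIndex t.1 (hB t.1 t.2) with hC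
  have hcard : C.card = B.card := by
    rw [hC, Finset.card_image_of_injective, Finset.card_attach]
    exact fun s t h => Subtype.ext (wordIndex_inj _ _ h)
  rw [← hcard, ← card_tileIndex, show (1 / 7 : ℝ) = 1 - 6 / 7 by norm_num,
    ← sum_disjoint_weight (6 / 7 : ℝ) C]
  refine Finset.sum_le_sum_of_subset_of_nonneg ?_ fun S _ _ => by positivity
  intro S hS
  simp only [Finset.mem_filter, Finset.mem_univ, true_and] at hS ⊢
  rw [Finset.disjoint_right]
  intro y hy
  obtain ⟨t, -, rfl⟩ := Finset.mem_image.1 hy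
  exact hS t.1 t.2 _

open Classical in
lemma sum_blocked_square_le (n : ℕ) :
    ∑ S : Finset (TileIndex n) with Blocked (Unavailable S) n ([], []),
      (6 / 7 : ℝ) ^ S.card * (1 - 6 / 7) ^ ((n + 1) * 2 ^ n - S.card) ≤ (16 / 17) ^ n := by
  have hmain := sum_blocked_le
    (fun S : Finset (TileIndex n) =>
      (6 / 7 : ℝ) ^ S.card * (1 - 6 / 7) ^ ((n + 1) * 2 ^ n - S.card))
    (fun S => by positivity) Unavailable n (sum_unavailable_le n) n 0 {([], [])} (by simp)
    (by simp) ⟨by simp, by simp⟩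
  have hcorners : corners {(([], []) : WordTile)} = ∅ := by
    ext p
    simp [mem_corners]
  rw [hcorners, Finset.card_empty, Finset.card_singleton, pow_zero, one_mul, Nat.sub_zero,
    pow_one] at hmain
  have hpow : (0 : ℝ) ≤ (16 / 17) ^ n := by positivity
  refine le_trans (Finset.sum_le_sum_of_subset_of_nonneg ?_ fun S _ _ => by positivity)
    (hmain.trans ((chainWeight_snd_le n).trans (by linarith)))
  intro S hS
  simp only [Finset.mem_filter, Finset.mem_univ, true_and, Finset.mem_singleton,
    forall_eq] at hS ⊢
  refine ⟨hS, fun X Y i l j hil hlj hj hi _ _ => ?_⟩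
  obtain rfl : l = i := by omega
  simpa using hi

/-- `T_n(6/7) ≥ 1 - (16/17)^n` for every `n`. -/
theorem tiling_prob_six_sevenths (n : ℕ) : T n (6 / 7) ≥ 1 - (16 / 17 : ℝ) ^ n := by
  classical
  set w : Finset (TileIndex n) → ℝ := fun S =>
    (6 / 7 : ℝ) ^ S.card * (1 - 6 / 7) ^ ((n + 1) * 2 ^ n - S.card) with hw
  have htotal : ∑ S, w S = 1 := by
    have h := sum_disjoint_weight (6 / 7 : ℝ) (∅ : Finset (TileIndex n))
    rw [card_tileIndex] at h
    simpa [hw] using h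
  have hT : T n (6 / 7) = ∑ S with TileableSquare n S, w S := by
    rw [T, Pr, Finset.sum_filter]
  have hsplit := Finset.sum_filter_add_sum_filter_not Finset.univ (TileableSquare n) w
  have hle : ∑ S with ¬ TileableSquare n S, w S ≤ (16 / 17) ^ n := by
    refine le_trans (Finset.sum_le_sum_of_subset_of_nonneg ?_ fun S _ _ => by positivity)
      (sum_blocked_square_le n)
    intro S hS
    simp only [Finset.mem_filter, Finset.mem_univ, true_and] at hS ⊢
    exact not_imp_comm.1 tileableSquare_of_not_blocked hS
  rw [htotal] at hsplit
  rw [hT]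
  linarith

end
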